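/- Let C^{ijk} (1 ≤ i,j,k ≤ m) be real numbers totally symmetric in their indices. Then the integral over the unit sphere S^{m-1} of (Σ_{i,j,k} C^{ijk} ξ_i ξ_j ξ_k)^2 equals (9|S^{m-1}| / (m(m+2)(m+4))) · ( (2/3)‖C‖² + |tr(C)|² ), where ‖C‖² = Σ_{i,j,k} (C^{ijk})² and tr(C)^i = Σ_j C^{ijj}, |tr(C)|² = Σ_i (tr(C)^i)². -/

import Mathlib

open MeasureTheory

section SphereFinite

/-- The radial projection to the unit sphere of the face `x i = s` of the cube `[-1, 1]^(n+1)`. -/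
noncomputable def cubeFaceToSphere {n : ℕ} (i : Fin (n + 1)) (s : ℝ) (y : Fin n → ℝ) :
    EuclideanSpace ℝ (Fin (n + 1)) :=
  ‖WithLp.toLp 2 (i.insertNth s y : Fin (n + 1) → ℝ)‖⁻¹ •
    WithLp.toLp 2 (i.insertNth s y : Fin (n + 1) → ℝ)

theorem contDiff_cubeFaceToSphere {n : ℕ} (i : Fin (n + 1)) {s : ℝ} (hs : s ≠ 0) :
    ContDiff ℝ 1 (cubeFaceToSphere i s : (Fin n → ℝ) → EuclideanSpace ℝ (Fin (n + 1))) := by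
  have h1 : ContDiff ℝ 1 fun y : Fin n → ℝ =>
      WithLp.toLp 2 (i.insertNth s y : Fin (n + 1) → ℝ) := by
    rw [contDiff_piLp]
    intro j
    refine i.succAboveCases ?_ (fun k => ?_) j
    · simpa using contDiff_const
    · simpa using contDiff_apply ℝ ℝ k
  have h0 : ∀ y : Fin n → ℝ, WithLp.toLp 2 (i.insertNth s y : Fin (n + 1) → ℝ) ≠ 0 := by
    intro y h
    have := congrArg (fun v : EuclideanSpace ℝ (Fin (n + 1)) => v i) h
    simp at this
    exact hs this
  exact ((h1.norm ℝ h0).inv fun y => norm_ne_zero_iff.2 (h0 y)).smul h1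

theorem hausdorffMeasure_image_lt_top_of_contDiff {n : ℕ} {F : Type*} [NormedAddCommGroup F]
    [NormedSpace ℝ F] [MeasurableSpace F] [BorelSpace F] {f : (Fin n → ℝ) → F}
    (hf : ContDiff ℝ 1 f) {K : Set (Fin n → ℝ)} (hK : IsCompact K) :
    μH[(n : ℝ)] (f '' K) < ⊤ := by
  have hloc : LocallyLipschitzOn K f := by
    intro x _
    obtain ⟨C, t, ht, h⟩ := (hf.contDiffAt (x := x)).exists_lipschitzOnWith
    exact ⟨C, t, mem_nhdsWithin_of_mem_nhds ht, h⟩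
  obtain ⟨C, hC⟩ := hloc.exists_lipschitzOnWith_of_compact hK
  refine (hC.hausdorffMeasure_image_le n.cast_nonneg).trans_lt ?_
  have hvol : (μH[(n : ℝ)] : Measure (Fin n → ℝ)) = volume := by
    simpa using hausdorffMeasure_pi_real (ι := Fin n)
  rw [hvol]
  exact ENNReal.mul_lt_top (by simp) hK.measure_lt_top

theorem hausdorffMeasure_sphere_lt_top (n : ℕ) :
    μH[(n : ℝ)] (Metric.sphere (0 : EuclideanSpace ℝ (Fin (n + 1))) 1) < ⊤ := by
  have hsub : Metric.sphere (0 : EuclideanSpace ℝ (Fin (n + 1))) 1 ⊆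
      ⋃ i : Fin (n + 1), ⋃ s : ℤˣ, cubeFaceToSphere i ((s : ℤ) : ℝ) '' Set.Icc (-1) 1 := by
    intro x hx
    have hx1 : ‖x‖ = 1 := by simpa using hx
    obtain ⟨i, hi⟩ := Finite.exists_max fun i => |x i|
    have hxi : 0 < |x i| := by
      rw [abs_pos]
      intro h0
      have : x = 0 := by
        ext j
        have := hi j
        simp only [h0, abs_zero] at this
        simpa using abs_nonpos_iff.1 this
      simp [this] at hx1
    obtain ⟨s, hs⟩ : ∃ s : ℤˣ, x i = |x i| * ((s : ℤ) : ℝ) := by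
      rcases abs_choice (x i) with h | h
      · exact ⟨1, by simp [h]⟩
      · exact ⟨-1, by simp [h]⟩
    have hz : WithLp.toLp 2 (i.insertNth ((s : ℤ) : ℝ) fun k => x (i.succAbove k) / |x i| :
        Fin (n + 1) → ℝ) = |x i|⁻¹ • x := by
      ext j
      refine i.succAboveCases ?_ (fun k => ?_) j
      · simp only [Fin.insertNth_apply_same, PiLp.smul_apply, smul_eq_mul]
        rw [eq_inv_mul_iff_mul_eq₀ hxi.ne', ← hs]
      · simp only [Fin.insertNth_apply_succAbove, PiLp.smul_apply, smul_eq_mul]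
        rw [div_eq_inv_mul]
    simp only [Set.mem_iUnion]
    refine ⟨i, s, fun k => x (i.succAbove k) / |x i|, ⟨fun k => ?_, fun k => ?_⟩, ?_⟩
    · have := hi (i.succAbove k)
      simp only [Pi.neg_apply, Pi.one_apply]
      rw [le_div_iff₀ hxi]
      linarith [neg_abs_le (x (i.succAbove k))]
    · have := hi (i.succAbove k)
      simp only [Pi.one_apply]
      rw [div_le_one hxi]
      linarith [le_abs_self (x (i.succAbove k))]
    · rw [cubeFaceToSphere, hz, norm_smul, hx1, smul_smul]
      simp [hxi.ne']
  refine (measure_mono hsub).trans_lt ?_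
  refine (measure_iUnion_fintype_le _ _).trans_lt (ENNReal.sum_lt_top.2 fun i _ =>
    (measure_iUnion_fintype_le _ _).trans_lt (ENNReal.sum_lt_top.2 fun s _ => ?_))
  exact hausdorffMeasure_image_lt_top_of_contDiff (contDiff_cubeFaceToSphere i (by simp))
    isCompact_Icc

end SphereFinite

section Invariance

theorem measurePreserving_hausdorffMeasure_restrict_sphere {E : Type*} [NormedAddCommGroup E]
    [NormedSpace ℝ E] [MeasurableSpace E] [BorelSpace E] (d : ℝ) (e : E ≃ₗᵢ[ℝ] E) :
    MeasurePreserving e (μH[d].restrict (Metric.sphere 0 1))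
      (μH[d].restrict (Metric.sphere 0 1)) := by
  have h := (e.toIsometryEquiv.measurePreserving_hausdorffMeasure d).restrict_preimage
    (s := Metric.sphere 0 1) Metric.isClosed_sphere.measurableSet
  have hpre : e.toIsometryEquiv ⁻¹' Metric.sphere 0 1 = Metric.sphere 0 1 := by
    ext x
    simp
  rw [hpre] at h
  exact h

variable {E : Type*} [NormedAddCommGroup E] [InnerProductSpace ℝ E] [FiniteDimensional ℝ E]
  [MeasurableSpace E] [BorelSpace E] {ν : Measure E} [IsFiniteMeasure ν]

omit [MeasurableSpace E] [BorelSpace E] in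
theorem exists_forall_norm_le_of_continuous {F : Type*} [NormedAddCommGroup F] {f : E → F}
    (hf : Continuous f) : ∃ M, ∀ x : E, ‖x‖ = 1 → ‖f x‖ ≤ M := by
  obtain ⟨M, hM⟩ := (isCompact_sphere (0 : E) 1).exists_bound_of_continuousOn hf.continuousOn
  exact ⟨M, fun x hx => hM x (by simpa using hx)⟩

theorem integrable_of_ae_norm_eq_one (hν : ∀ᵐ x ∂ν, ‖x‖ = 1) {f : E → ℝ} (hf : Continuous f) :
    Integrable f ν := by
  obtain ⟨M, hM⟩ := exists_forall_norm_le_of_continuous hf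
  exact Integrable.of_bound hf.aestronglyMeasurable M (hν.mono hM)

/-- The infinitesimal generators of rotations integrate to zero against a rotation invariant
measure on the unit sphere. -/
theorem integral_fderiv_skewAdjoint_eq_zero (hν : ∀ᵐ x ∂ν, ‖x‖ = 1)
    (hinv : ∀ e : E ≃ₗᵢ[ℝ] E, MeasurePreserving e ν ν) {f : E → ℝ} (hf : ContDiff ℝ 1 f)
    {A : E →L[ℝ] E} (hA : A ∈ skewAdjoint (E →L[ℝ] E)) :
    ∫ x, fderiv ℝ f x (A x) ∂ν = 0 := by
  let : NormedAlgebra ℚ (E →L[ℝ] E) := .restrictScalars ℚ ℝ _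
  let e : ℝ → (E ≃ₗᵢ[ℝ] E) := fun t => Unitary.linearIsometryEquiv
    ⟨NormedSpace.exp (t • A),
      NormedSpace.exp_mem_unitary_of_mem_skewAdjoint (skewAdjoint.smul_mem t hA)⟩
  have he : ∀ t x, e t x = NormedSpace.exp (t • A) x := fun t x => rfl
  have he0 : ∀ x, e 0 x = x := fun x => by simp [he]
  have hderiv : ∀ t x, HasDerivAt (fun t => e t x) (e t (A x)) t := by
    intro t x
    simp only [he]
    exact (hasDerivAt_exp_smul_const A t).clm_apply (hasDerivAt_const t x) |>.congr_deriv
      (by simp)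
  obtain ⟨M, hM⟩ := exists_forall_norm_le_of_continuous (hf.continuous_fderiv one_ne_zero)
  have key := hasDerivAt_integral_of_dominated_loc_of_deriv_le (μ := ν) (x₀ := (0 : ℝ))
    (F := fun t x => f (e t x)) (F' := fun t x => fderiv ℝ f (e t x) (e t (A x)))
    (bound := fun _ => M * ‖A‖) (s := Set.univ) Filter.univ_mem
    (.of_forall fun t => (hf.continuous.comp (e t).continuous).aestronglyMeasurable)
    (integrable_of_ae_norm_eq_one hν (hf.continuous.comp (e 0).continuous))
    (((hf.continuous_fderiv one_ne_zero).comp (e 0).continuous).clm_apply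
      ((e 0).continuous.comp A.continuous)).aestronglyMeasurable
    (hν.mono fun x hx t _ => by
      have h1 : ‖e t x‖ = 1 := by simpa using hx
      have h2 : ‖e t (A x)‖ ≤ ‖A‖ := by simpa [hx] using A.le_opNorm x
      exact (ContinuousLinearMap.le_opNorm _ _).trans
        (mul_le_mul (hM _ h1) h2 (norm_nonneg _) ((norm_nonneg _).trans (hM _ h1))))
    (integrable_const _)
    (.of_forall fun x t _ =>
      ((hf.differentiable one_ne_zero).differentiableAt.hasFDerivAt).comp_hasDerivAt t
        (hderiv t x))
  have hconst : (fun t => ∫ x, f (e t x) ∂ν) = fun _ => ∫ x, f x ∂ν := by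
    funext t
    exact (hinv (e t)).integral_comp (e t).toHomeomorph.measurableEmbedding f
  have h := key.2
  rw [hconst] at h
  simpa [he0] using h.unique (hasDerivAt_const _ _)

end Invariance

section Polynomial

open MvPolynomial

variable {m : ℕ}

theorem hasFDerivAt_eval_euclidean (p : MvPolynomial (Fin m) ℝ) (x : EuclideanSpace ℝ (Fin m)) :
    HasFDerivAt (fun y : EuclideanSpace ℝ (Fin m) => eval (fun i => y i) p)
      (∑ i, eval (fun i => x i) (pderiv i p) • EuclideanSpace.proj (𝕜 := ℝ) i) x := by
  induction p using MvPolynomial.induction_on with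
  | C a => simpa using hasFDerivAt_const a x
  | add p q hp hq =>
    simp only [map_add, add_smul, Finset.sum_add_distrib]
    exact hp.add hq
  | mul_X p j hp =>
    have hX : HasFDerivAt (fun y : EuclideanSpace ℝ (Fin m) => y j)
        (EuclideanSpace.proj (𝕜 := ℝ) j) x := (EuclideanSpace.proj (𝕜 := ℝ) j).hasFDerivAt
    have h := hp.mul hX
    simp only [map_mul, eval_X]
    refine h.congr_fderiv ?_
    ext v
    simp [pderiv_X, Pi.single_apply, Finset.sum_add_distrib, Finset.mul_sum, add_mul, apply_ite,
      mul_assoc]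

theorem contDiff_eval_euclidean (p : MvPolynomial (Fin m) ℝ) :
    ContDiff ℝ 1 (fun y : EuclideanSpace ℝ (Fin m) => eval (fun i => y i) p) := by
  induction p using MvPolynomial.induction_on with
  | C a => simpa using contDiff_const
  | add p q hp hq => simpa using hp.add hq
  | mul_X p j hp =>
    simpa using hp.mul (contDiff_piLp_apply (𝕜 := ℝ) (p := 2) (i := j))

/-- Integration of polynomials against `ν`. -/
noncomputable def polyIntegral (ν : Measure (EuclideanSpace ℝ (Fin m)))
    (p : MvPolynomial (Fin m) ℝ) : ℝ :=
  ∫ x, eval (fun i => x i) p ∂ν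

variable {ν : Measure (EuclideanSpace ℝ (Fin m))} [IsFiniteMeasure ν]

theorem polyIntegral_add (hν : ∀ᵐ x ∂ν, ‖x‖ = 1) (p q : MvPolynomial (Fin m) ℝ) :
    polyIntegral ν (p + q) = polyIntegral ν p + polyIntegral ν q := by
  simp only [polyIntegral, map_add]
  exact integral_add (integrable_of_ae_norm_eq_one hν (contDiff_eval_euclidean p).continuous)
    (integrable_of_ae_norm_eq_one hν (contDiff_eval_euclidean q).continuous)

theorem polyIntegral_sum (hν : ∀ᵐ x ∂ν, ‖x‖ = 1) {ι : Type*} (s : Finset ι)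
    (p : ι → MvPolynomial (Fin m) ℝ) :
    polyIntegral ν (∑ i ∈ s, p i) = ∑ i ∈ s, polyIntegral ν (p i) := by
  simp only [polyIntegral, map_sum]
  exact integral_finsetSum _ fun i _ =>
    integrable_of_ae_norm_eq_one hν (contDiff_eval_euclidean (p i)).continuous

omit [IsFiniteMeasure ν] in
theorem polyIntegral_C_mul (a : ℝ) (p : MvPolynomial (Fin m) ℝ) :
    polyIntegral ν (C a * p) = a * polyIntegral ν p := by
  simp [polyIntegral, integral_const_mul]

omit [IsFiniteMeasure ν] in
theorem polyIntegral_C (a : ℝ) :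
    polyIntegral ν (C a) = a * ν.real Set.univ := by
  simp [polyIntegral, mul_comm]

/-- The generator of the rotations in the plane spanned by the `a`-th and `b`-th axes. -/
noncomputable def rotationGenerator (a b : Fin m) :
    EuclideanSpace ℝ (Fin m) →L[ℝ] EuclideanSpace ℝ (Fin m) :=
  (EuclideanSpace.proj (𝕜 := ℝ) a).smulRight (EuclideanSpace.single b 1) -
    (EuclideanSpace.proj (𝕜 := ℝ) b).smulRight (EuclideanSpace.single a 1)

theorem rotationGenerator_mem_skewAdjoint (a b : Fin m) :
    rotationGenerator a b ∈
      skewAdjoint (EuclideanSpace ℝ (Fin m) →L[ℝ] EuclideanSpace ℝ (Fin m)) := by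
  rw [skewAdjoint.mem_iff, ContinuousLinearMap.star_eq_adjoint, eq_comm,
    ContinuousLinearMap.eq_adjoint_iff]
  intro x y
  simp [rotationGenerator, inner_sub_left, inner_sub_right, real_inner_smul_left,
    real_inner_smul_right, EuclideanSpace.inner_single_left, EuclideanSpace.inner_single_right]
  ring

theorem polyIntegral_rotation (hν : ∀ᵐ x ∂ν, ‖x‖ = 1)
    (hinv : ∀ e : EuclideanSpace ℝ (Fin m) ≃ₗᵢ[ℝ] EuclideanSpace ℝ (Fin m),
      MeasurePreserving e ν ν) (a b : Fin m) (p : MvPolynomial (Fin m) ℝ) :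
    polyIntegral ν (X a * pderiv b p - X b * pderiv a p) = 0 := by
  rw [← integral_fderiv_skewAdjoint_eq_zero hν hinv (contDiff_eval_euclidean p)
    (rotationGenerator_mem_skewAdjoint a b)]
  refine integral_congr_ae (.of_forall fun x => ?_)
  simp only [(hasFDerivAt_eval_euclidean p x).fderiv]
  simp [rotationGenerator, mul_comm, sub_mul, Finset.sum_sub_distrib]

omit [IsFiniteMeasure ν] in
theorem polyIntegral_sum_X_sq_mul (hν : ∀ᵐ x ∂ν, ‖x‖ = 1) (p : MvPolynomial (Fin m) ℝ) :
    polyIntegral ν ((∑ a, X a * X a) * p) = polyIntegral ν p := by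
  refine integral_congr_ae (hν.mono fun x hx => ?_)
  have : ∑ a, x a * x a = 1 := by
    have h := EuclideanSpace.real_norm_sq_eq x
    rw [hx] at h
    simpa [sq] using h.symm
  simp [this]

/-- Integration by parts for a homogeneous polynomial on the sphere. -/
theorem polyIntegral_X_mul (hν : ∀ᵐ x ∂ν, ‖x‖ = 1)
    (hinv : ∀ e : EuclideanSpace ℝ (Fin m) ≃ₗᵢ[ℝ] EuclideanSpace ℝ (Fin m),
      MeasurePreserving e ν ν) {d : ℕ} {q : MvPolynomial (Fin m) ℝ} (hq : q.IsHomogeneous d)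
    (b : Fin m) :
    ((m : ℝ) + d - 1) * polyIntegral ν (X b * q) = polyIntegral ν (pderiv b q) := by
  have hsum : polyIntegral ν
      (∑ a, (X a * pderiv b (X a * q) - X b * pderiv a (X a * q))) = 0 := by
    rw [polyIntegral_sum hν]
    exact Finset.sum_eq_zero fun a _ => polyIntegral_rotation hν hinv a b _
  have halg : (∑ a, (X a * pderiv b (X a * q) - X b * pderiv a (X a * q))) +
      C ((m : ℝ) + d - 1) * (X b * q) = (∑ a, X a * X a) * pderiv b q := by
    have heul := hq.sum_X_mul_pderiv
    have h1 : ∀ a, X a * pderiv b (X a * q) - X b * pderiv a (X a * q) =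
        X a * X a * pderiv b q + (if a = b then X b * q else 0) -
          (X b * q + X b * (X a * pderiv a q)) := by
      intro a
      by_cases h : a = b
      · subst h
        simp [Derivation.leibniz]
        ring
      · simp [Derivation.leibniz, pderiv_X_of_ne h, h]
        ring
    simp only [h1, Finset.sum_sub_distrib, Finset.sum_add_distrib, ← Finset.mul_sum,
      ← Finset.sum_mul, heul]
    simp
    ring
  rw [← polyIntegral_sum_X_sq_mul hν (pderiv b q), ← halg, polyIntegral_add hν, hsum, polyIntegral_C_mul,
    zero_add]

/-- The linear form obtained by contracting the last index of `c` with the coordinates. -/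
noncomputable def contractOne (c : Fin m → Fin m → Fin m → ℝ) (i j : Fin m) :
    MvPolynomial (Fin m) ℝ :=
  ∑ k, C (c i j k) * X k

/-- The quadratic form obtained by contracting the last two indices of `c` with the
coordinates. -/
noncomputable def contractTwo (c : Fin m → Fin m → Fin m → ℝ) (i : Fin m) :
    MvPolynomial (Fin m) ℝ :=
  ∑ j, X j * contractOne c i j

/-- The cubic form of `c`. -/
noncomputable def contractThree (c : Fin m → Fin m → Fin m → ℝ) : MvPolynomial (Fin m) ℝ :=
  ∑ i, X i * contractTwo c i

variable {c : Fin m → Fin m → Fin m → ℝ}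

theorem isHomogeneous_contractOne (i j : Fin m) : (contractOne c i j).IsHomogeneous 1 :=
  IsHomogeneous.sum _ _ _ fun k _ => by
    simpa using (isHomogeneous_C (Fin m) (c i j k)).mul (isHomogeneous_X ℝ k)

theorem isHomogeneous_contractTwo (i : Fin m) : (contractTwo c i).IsHomogeneous 2 :=
  IsHomogeneous.sum _ _ _ fun j _ => (isHomogeneous_X ℝ j).mul (isHomogeneous_contractOne i j)

theorem isHomogeneous_contractThree : (contractThree c).IsHomogeneous 3 :=
  IsHomogeneous.sum _ _ _ fun i _ => (isHomogeneous_X ℝ i).mul (isHomogeneous_contractTwo i)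

theorem pderiv_contractOne (b i j : Fin m) : pderiv b (contractOne c i j) = C (c i j b) := by
  simp [contractOne, pderiv_X, Pi.single_apply]

theorem pderiv_contractTwo (hc : ∀ i j k, c i j k = c i k j) (b i : Fin m) :
    pderiv b (contractTwo c i) = 2 * contractOne c i b := by
  have h : ∑ j, X j * C (c i j b) = contractOne c i b :=
    Finset.sum_congr rfl fun j _ => by rw [hc i j b, mul_comm]
  simp [contractTwo, Derivation.leibniz, pderiv_contractOne, pderiv_X, Pi.single_apply,
    Finset.sum_add_distrib, h]
  ring

theorem pderiv_contractThree (hc : ∀ i j k, c i j k = c i k j) (hc' : ∀ i j k, c i j k = c j i k)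
    (b : Fin m) : pderiv b (contractThree c) = 3 * contractTwo c b := by
  have h : ∑ i, X i * (2 * contractOne c i b) = 2 * contractTwo c b := by
    rw [contractTwo, Finset.mul_sum]
    refine Finset.sum_congr rfl fun i _ => ?_
    have : contractOne c i b = contractOne c b i :=
      Finset.sum_congr rfl fun k _ => by rw [hc' i b k]
    rw [this]
    ring
  simp [contractThree, Derivation.leibniz, pderiv_contractTwo hc, pderiv_X, Pi.single_apply,
    Finset.sum_add_distrib, h]
  ring

theorem polyIntegral_sum_X_mul (hν : ∀ᵐ x ∂ν, ‖x‖ = 1)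
    (hinv : ∀ e : EuclideanSpace ℝ (Fin m) ≃ₗᵢ[ℝ] EuclideanSpace ℝ (Fin m),
      MeasurePreserving e ν ν) {d : ℕ} {q : Fin m → MvPolynomial (Fin m) ℝ}
    (hq : ∀ i, (q i).IsHomogeneous d) :
    ((m : ℝ) + d - 1) * polyIntegral ν (∑ i, X i * q i) =
      ∑ i, polyIntegral ν (pderiv i (q i)) := by
  rw [polyIntegral_sum hν, Finset.mul_sum]
  exact Finset.sum_congr rfl fun i _ => polyIntegral_X_mul hν hinv (hq i) i

theorem polyIntegral_contractOne_mul (hν : ∀ᵐ x ∂ν, ‖x‖ = 1)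
    (hinv : ∀ e : EuclideanSpace ℝ (Fin m) ≃ₗᵢ[ℝ] EuclideanSpace ℝ (Fin m),
      MeasurePreserving e ν ν) {d : ℕ} {q : MvPolynomial (Fin m) ℝ} (hq : q.IsHomogeneous d)
    (i j : Fin m) :
    ((m : ℝ) + d - 1) * polyIntegral ν (contractOne c i j * q) =
      ∑ k, c i j k * polyIntegral ν (pderiv k q) := by
  have h : contractOne c i j * q = ∑ k, C (c i j k) * (X k * q) := by
    simp [contractOne, Finset.sum_mul, mul_assoc]
  rw [h, polyIntegral_sum hν, Finset.mul_sum]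
  refine Finset.sum_congr rfl fun k _ => ?_
  rw [polyIntegral_C_mul, ← polyIntegral_X_mul hν hinv hq]
  ring

theorem polyIntegral_contractTwo (hν : ∀ᵐ x ∂ν, ‖x‖ = 1)
    (hinv : ∀ e : EuclideanSpace ℝ (Fin m) ≃ₗᵢ[ℝ] EuclideanSpace ℝ (Fin m),
      MeasurePreserving e ν ν) (i : Fin m) :
    (m : ℝ) * polyIntegral ν (contractTwo c i) = (∑ j, c i j j) * ν.real Set.univ := by
  have h := polyIntegral_sum_X_mul hν hinv fun j => isHomogeneous_contractOne (c := c) i j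
  simp only [pderiv_contractOne, polyIntegral_C, ← Finset.sum_mul] at h
  rw [← h, contractTwo]
  simp

theorem polyIntegral_contractOne_sq (hν : ∀ᵐ x ∂ν, ‖x‖ = 1)
    (hinv : ∀ e : EuclideanSpace ℝ (Fin m) ≃ₗᵢ[ℝ] EuclideanSpace ℝ (Fin m),
      MeasurePreserving e ν ν) (i j : Fin m) :
    (m : ℝ) * polyIntegral ν (contractOne c i j * contractOne c i j) =
      (∑ k, c i j k ^ 2) * ν.real Set.univ := by
  have h := polyIntegral_contractOne_mul (c := c) hν hinv
    (isHomogeneous_contractOne (c := c) i j) i j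
  simp only [pderiv_contractOne, polyIntegral_C, ← mul_assoc, ← Finset.sum_mul, ← sq] at h
  rw [← h, sq]
  simp

theorem polyIntegral_contractTwo_sq (hν : ∀ᵐ x ∂ν, ‖x‖ = 1)
    (hinv : ∀ e : EuclideanSpace ℝ (Fin m) ≃ₗᵢ[ℝ] EuclideanSpace ℝ (Fin m),
      MeasurePreserving e ν ν) (hc : ∀ i j k, c i j k = c i k j) (i : Fin m) :
    (m : ℝ) * ((m : ℝ) + 2) * polyIntegral ν (contractTwo c i * contractTwo c i) =
      ((∑ j, c i j j) ^ 2 + 2 * ∑ j, ∑ k, c i j k ^ 2) * ν.real Set.univ := by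
  have h := polyIntegral_sum_X_mul hν hinv fun j =>
    (isHomogeneous_contractOne (c := c) i j).mul (isHomogeneous_contractTwo (c := c) i)
  have hd : ∀ j, pderiv j (contractOne c i j * contractTwo c i) =
      C (c i j j) * contractTwo c i + C 2 * (contractOne c i j * contractOne c i j) := by
    intro j
    rw [Derivation.leibniz, pderiv_contractOne, pderiv_contractTwo hc]
    simp only [smul_eq_mul, map_ofNat]
    ring
  have hA : ∑ j, X j * (contractOne c i j * contractTwo c i) =
      contractTwo c i * contractTwo c i := by
    simp_rw [← mul_assoc, ← Finset.sum_mul]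
    rfl
  simp only [hd, hA, polyIntegral_add hν, polyIntegral_C_mul, Finset.sum_add_distrib,
    ← Finset.sum_mul, ← Finset.mul_sum] at h
  have h2 := polyIntegral_contractTwo (c := c) hν hinv i
  have h1 : (m : ℝ) * ∑ j, polyIntegral ν (contractOne c i j * contractOne c i j) =
      (∑ j, ∑ k, c i j k ^ 2) * ν.real Set.univ := by
    simp only [Finset.mul_sum, Finset.sum_mul, polyIntegral_contractOne_sq hν hinv]
  push_cast at h
  linear_combination (m : ℝ) * h + (∑ j, c i j j) * h2 + 2 * h1

theorem polyIntegral_contractThree_sq (hν : ∀ᵐ x ∂ν, ‖x‖ = 1)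
    (hinv : ∀ e : EuclideanSpace ℝ (Fin m) ≃ₗᵢ[ℝ] EuclideanSpace ℝ (Fin m),
      MeasurePreserving e ν ν) (hc : ∀ i j k, c i j k = c i k j)
    (hc' : ∀ i j k, c i j k = c j i k) :
    (m : ℝ) * ((m : ℝ) + 2) * ((m : ℝ) + 4) *
        polyIntegral ν (contractThree c * contractThree c) =
      (6 * (∑ i, ∑ j, ∑ k, c i j k ^ 2) + 9 * ∑ i, (∑ j, c i j j) ^ 2) * ν.real Set.univ := by
  have h := polyIntegral_sum_X_mul hν hinv fun i =>
    (isHomogeneous_contractTwo (c := c) i).mul (isHomogeneous_contractThree (c := c))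
  have hd : ∀ i, pderiv i (contractTwo c i * contractThree c) =
      C 2 * (contractOne c i i * contractThree c) + C 3 * (contractTwo c i * contractTwo c i) := by
    intro i
    rw [Derivation.leibniz, pderiv_contractTwo hc, pderiv_contractThree hc hc']
    simp only [smul_eq_mul, map_ofNat]
    ring
  have hP : ∑ i, X i * (contractTwo c i * contractThree c) =
      contractThree c * contractThree c := by
    simp_rw [← mul_assoc, ← Finset.sum_mul]
    rfl
  simp only [hd, hP, polyIntegral_add hν, polyIntegral_C_mul, Finset.sum_add_distrib,
    ← Finset.mul_sum] at h
  have hT : (m : ℝ) * ((m : ℝ) + 2) *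
      ∑ i, polyIntegral ν (contractOne c i i * contractThree c) =
      3 * (∑ i, (∑ j, c i j j) ^ 2) * ν.real Set.univ := by
    have h1 : ∀ i, ((m : ℝ) + 2) * polyIntegral ν (contractOne c i i * contractThree c) =
        ∑ k, c k i i * (3 * polyIntegral ν (contractTwo c k)) := by
      intro i
      have := polyIntegral_contractOne_mul (c := c) hν hinv
        (isHomogeneous_contractThree (c := c)) i i
      have h3 : (3 : MvPolynomial (Fin m) ℝ) = C 3 := (map_ofNat C 3).symm
      simp only [pderiv_contractThree hc hc', h3, polyIntegral_C_mul] at this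
      have h4 : ∀ k, c k i i = c i i k := fun k => by rw [hc i i k, hc' i k i]
      simp only [h4, ← this]
      push_cast
      ring
    rw [mul_assoc, Finset.mul_sum, Finset.sum_congr rfl fun i _ => h1 i, Finset.sum_comm,
      Finset.mul_sum, Finset.mul_sum, Finset.sum_mul]
    refine Finset.sum_congr rfl fun k _ => ?_
    rw [← Finset.sum_mul]
    linear_combination 3 * (∑ j, c k j j) * polyIntegral_contractTwo (c := c) hν hinv k
  have hA : (m : ℝ) * ((m : ℝ) + 2) * ∑ i, polyIntegral ν (contractTwo c i * contractTwo c i) =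
      ((∑ i, (∑ j, c i j j) ^ 2) + 2 * ∑ i, ∑ j, ∑ k, c i j k ^ 2) * ν.real Set.univ := by
    rw [Finset.mul_sum, Finset.sum_congr rfl fun i _ => polyIntegral_contractTwo_sq hν hinv hc i,
      ← Finset.sum_mul, Finset.sum_add_distrib, Finset.mul_sum]
  push_cast at h
  linear_combination (m : ℝ) * ((m : ℝ) + 2) * h + 2 * hT + 3 * hA

theorem eval_contractThree (x : Fin m → ℝ) :
    eval x (contractThree c) = ∑ i, ∑ j, ∑ k, c i j k * x i * x j * x k := by
  simp only [contractThree, contractTwo, contractOne, map_sum, map_mul, eval_X, eval_C,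
    Finset.mul_sum]
  refine Finset.sum_congr rfl fun i _ => Finset.sum_congr rfl fun j _ =>
    Finset.sum_congr rfl fun k _ => ?_
  ring

end Polynomial

theorem sphere_integral_cubic_sq (m : ℕ) (C : Fin m → Fin m → Fin m → ℝ)
    (hsymm : ∀ i j k : Fin m, C i j k = C j i k ∧ C i j k = C i k j) :
    ∫ ξ in Metric.sphere (0 : EuclideanSpace ℝ (Fin m)) 1,
        (∑ i, ∑ j, ∑ k, C i j k * ξ i * ξ j * ξ k) ^ 2 ∂(μH[(m : ℝ) - 1]) =
      9 * (μH[(m : ℝ) - 1] (Metric.sphere (0 : EuclideanSpace ℝ (Fin m)) 1)).toReal /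
          ((m : ℝ) * ((m : ℝ) + 2) * ((m : ℝ) + 4)) *
        ((2 / 3) * (∑ i, ∑ j, ∑ k, (C i j k) ^ 2) + ∑ i, (∑ j, C i j j) ^ 2) := by
  rcases m with _ | n
  · simp
  have hexp : ((n + 1 : ℕ) : ℝ) - 1 = n := by simp
  have hfin : μH[((n + 1 : ℕ) : ℝ) - 1] (Metric.sphere (0 : EuclideanSpace ℝ (Fin (n + 1))) 1)
      < ⊤ := hexp ▸ hausdorffMeasure_sphere_lt_top n
  set ν := (μH[((n + 1 : ℕ) : ℝ) - 1] : Measure (EuclideanSpace ℝ (Fin (n + 1)))).restrict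
    (Metric.sphere 0 1) with hνdef
  have : IsFiniteMeasure ν := ⟨by simpa [hνdef] using hfin⟩
  have hν : ∀ᵐ x ∂ν, ‖x‖ = 1 := by
    filter_upwards [ae_restrict_mem Metric.isClosed_sphere.measurableSet] with x hx
    simpa using hx
  have key := polyIntegral_contractThree_sq hν
    (measurePreserving_hausdorffMeasure_restrict_sphere _)
    (fun i j k => (hsymm i j k).2) (fun i j k => (hsymm i j k).1)
  have hint : polyIntegral ν (contractThree C * contractThree C) =
      ∫ ξ, (∑ i, ∑ j, ∑ k, C i j k * ξ i * ξ j * ξ k) ^ 2 ∂ν := by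
    simp only [polyIntegral, map_mul, eval_contractThree, sq]
  have huniv : ν.real Set.univ = (μH[((n + 1 : ℕ) : ℝ) - 1]
      (Metric.sphere (0 : EuclideanSpace ℝ (Fin (n + 1))) 1)).toReal := by
    simp [Measure.real, hνdef]
  rw [hint, huniv] at key
  rw [div_mul_eq_mul_div, eq_div_iff (by positivity)]
  linear_combination key
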